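/- For n ≥ 0 and k ∈ ℤ, let m_k(n) denote the number of elements b of the n-fold crystal tensor power B(1)^{⊗n} (with left-bracketed tensor product) such that e·b = 0 and wt(b) = k. Then m_k(n) = C(n, (n−k)/2) − C(n, (n−k)/2 − 1) if 0 ≤ k ≤ n and n − k is even, and m_k(n) = 0 otherwise (where C(a,b) is the binomial coefficient, taken to be 0 for b < 0). -/

import Mathlib

/-! Preamble: finite `sl₂`-crystals (data), the normality axioms, morphisms,
the standard crystals `B(n)`, tensor products and direct sums. -/

/-- The underlying data of a finite `sl₂`-crystal: a finite set `carrier` with maps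
`wt, ε, φ : carrier → ℤ` and `e, f : carrier → carrier ⊔ {0}` (we use `Option`,
with `none` playing the role of `0`). -/
structure Crystal where
  carrier : Type
  [fintype : Fintype carrier]
  wt : carrier → ℤ
  eps : carrier → ℤ
  phi : carrier → ℤ
  e : carrier → Option carrier
  f : carrier → Option carrier

attribute [instance] Crystal.fintype

namespace Crystal

/-- `n`-fold iteration of `e` (with `e 0 = 0`). -/
def eIter (c : Crystal) : ℕ → c.carrier → Option c.carrier
  | 0, b => some b
  | n + 1, b => (c.e b).bind (c.eIter n)

/-- `n`-fold iteration of `f` (with `f 0 = 0`). -/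
def fIter (c : Crystal) : ℕ → c.carrier → Option c.carrier
  | 0, b => some b
  | n + 1, b => (c.f b).bind (c.fIter n)

/-- The axioms of a (finite) normal `sl₂`-crystal:
(1) `φ b = ε b + wt b`;
(2) if `e b ≠ 0` then `wt (e b) = wt b + 2`, `ε (e b) = ε b - 1`, `φ (e b) = φ b + 1`;
(3) if `f b ≠ 0` then `wt (f b) = wt b - 2`, `ε (f b) = ε b + 1`, `φ (f b) = φ b - 1`;
(4) `b = e b'` iff `f b = b'`;
(5) `ε b = max {n | eⁿ b ≠ 0}` and `φ b = max {n | fⁿ b ≠ 0}` (expressed as: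
`eⁿ b ≠ 0` iff `n ≤ ε b`, and `fⁿ b ≠ 0` iff `n ≤ φ b`). -/
def IsNormal (c : Crystal) : Prop :=
  (∀ b, c.phi b = c.eps b + c.wt b) ∧
  (∀ b b', c.e b = some b' →
    c.wt b' = c.wt b + 2 ∧ c.eps b' = c.eps b - 1 ∧ c.phi b' = c.phi b + 1) ∧
  (∀ b b', c.f b = some b' →
    c.wt b' = c.wt b - 2 ∧ c.eps b' = c.eps b + 1 ∧ c.phi b' = c.phi b - 1) ∧
  (∀ b b', c.e b' = some b ↔ c.f b = some b') ∧
  (∀ b (n : ℕ), (c.eIter n b).isSome ↔ (n : ℤ) ≤ c.eps b) ∧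
  (∀ b (n : ℕ), (c.fIter n b).isSome ↔ (n : ℤ) ≤ c.phi b)

/-- A morphism of crystals `A → B` is a map `A → B ⊔ {0}` compatible with
`e`, `f`, `ε`, `φ` and `wt` (with the convention that it sends `0` to `0`). -/
def IsHom (A B : Crystal) (β : A.carrier → Option B.carrier) : Prop :=
  (∀ a b, β a = some b → B.wt b = A.wt a ∧ B.eps b = A.eps a ∧ B.phi b = A.phi a) ∧
  (∀ a, (A.e a).bind β = (β a).bind B.e) ∧
  (∀ a, (A.f a).bind β = (β a).bind B.f)

/-- `β : A → B` and `γ : B → A` constitute a pair of mutually inverse isomorphisms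
of crystals. -/
def IsIsoPair (A B : Crystal) (β : A.carrier → Option B.carrier)
    (γ : B.carrier → Option A.carrier) : Prop :=
  IsHom A B β ∧ IsHom B A γ ∧ (∀ a, (β a).bind γ = some a) ∧ (∀ b, (γ b).bind β = some b)

/-- The standard crystal `B(n) = {vₙ, vₙ₋₂, …, v₋ₙ}`; the element `vₙ₋₂ₖ` is encoded
as `k : Fin (n+1)`; `wt vₖ = k`, `e vₙ = 0`, `e vₖ = vₖ₊₂` for `k < n`. -/
def B (n : ℕ) : Crystal where
  carrier := Fin (n + 1)
  wt j := (n : ℤ) - 2 * (j : ℤ)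
  eps j := (j : ℤ)
  phi j := (n : ℤ) - (j : ℤ)
  e j := if h : (j : ℕ) = 0 then none else some ⟨(j : ℕ) - 1, by omega⟩
  f j := if h : (j : ℕ) = n then none else some ⟨(j : ℕ) + 1, by omega⟩

/-- Tensor product of crystals (Kashiwara's convention, as in the paper):
`e (a ⊗ b) = ea ⊗ b` if `ε a > φ b` and `a ⊗ eb` otherwise, etc. -/
def tensor (A B : Crystal) : Crystal where
  carrier := A.carrier × B.carrier
  wt p := A.wt p.1 + B.wt p.2
  eps p := max (B.eps p.2) (A.eps p.1 - B.wt p.2)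
  phi p := max (A.phi p.1) (B.phi p.2 + A.wt p.1)
  e p := if A.eps p.1 > B.phi p.2 then (A.e p.1).map (fun a => (a, p.2))
         else (B.e p.2).map (fun b => (p.1, b))
  f p := if A.eps p.1 ≥ B.phi p.2 then (A.f p.1).map (fun a => (a, p.2))
         else (B.f p.2).map (fun b => (p.1, b))

/-- Direct sum (disjoint union) of crystals. -/
def dsum (A B : Crystal) : Crystal where
  carrier := A.carrier ⊕ B.carrier
  wt := Sum.elim A.wt B.wt
  eps := Sum.elim A.eps B.eps
  phi := Sum.elim A.phi B.phi
  e := Sum.elim (fun a => (A.e a).map Sum.inl) (fun b => (B.e b).map Sum.inr)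
  f := Sum.elim (fun a => (A.f a).map Sum.inl) (fun b => (B.f b).map Sum.inr)

end Crystal

/-- The element `v_{n-2k}` of the standard crystal `B(n)`. -/
def Crystal.vB (n : ℕ) (k : Fin (n + 1)) : (Crystal.B n).carrier := k

open Crystal

/-- The left-bracketed tensor power `B(1)^{⊗n}`, with `B(1)^{⊗0} = B(0)` the unit. -/
def tpowB1 : ℕ → Crystal
  | 0 => B 0
  | n + 1 => tensor (tpowB1 n) (B 1)

/-- `m_k(n)`: the number of elements `b` of `B(1)^{⊗n}` with `e b = 0` and `wt b = k`. -/
noncomputable def mCount (n : ℕ) (k : ℤ) : ℕ :=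
  Nat.card {b : (tpowB1 n).carrier // (tpowB1 n).e b = none ∧ (tpowB1 n).wt b = k}

/-- The binomial coefficient `C(n, z)` for `z ∈ ℤ`, equal to `0` for `z < 0`. -/
def intChoose (n : ℕ) (z : ℤ) : ℤ :=
  if 0 ≤ z then (n.choose z.toNat : ℤ) else 0

/-- Pascal's rule for `intChoose`. -/
theorem intChoose_succ (n : ℕ) (z : ℤ) :
    intChoose (n + 1) z = intChoose n z + intChoose n (z - 1) := by
  unfold intChoose
  rcases lt_trichotomy z 0 with hz | rfl | hz
  · rw [if_neg (by omega), if_neg (by omega), if_neg (by omega), add_zero]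
  · simp
  · obtain ⟨m, rfl⟩ : ∃ m : ℕ, z = m + 1 := ⟨(z - 1).toNat, by omega⟩
    have h : ((m : ℤ) + 1).toNat = m + 1 := by omega
    rw [if_pos (by omega), if_pos (by omega), if_pos (by omega), h]
    simp only [add_sub_cancel_right, Int.toNat_natCast, Nat.choose_succ_succ]
    push_cast
    ring

/-- The number of sequences of `n` signs `±1` with sum `k`. -/
def signSeqCount (n : ℕ) (k : ℤ) : ℤ :=
  if 2 ∣ (n : ℤ) - k then intChoose n (((n : ℤ) - k) / 2) else 0

theorem signSeqCount_zero (k : ℤ) : signSeqCount 0 k = if k = 0 then 1 else 0 := by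
  unfold signSeqCount intChoose
  rcases lt_trichotomy k 0 with hk | rfl | hk
  · rw [if_neg hk.ne]
    split_ifs with h₁ h₂
    · rw [Nat.choose_eq_zero_of_lt (by omega), Nat.cast_zero]
    · rfl
    · rfl
  · simp
  · rw [if_neg hk.ne']
    split_ifs
    · omega
    · rfl
    · rfl

theorem signSeqCount_succ (n : ℕ) (k : ℤ) :
    signSeqCount (n + 1) k = signSeqCount n (k - 1) + signSeqCount n (k + 1) := by
  unfold signSeqCount
  by_cases h : 2 ∣ (n : ℤ) + 1 - k
  · have h₁ : ((n : ℤ) - (k - 1)) / 2 = ((n : ℤ) + 1 - k) / 2 := by omega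
    have h₂ : ((n : ℤ) - (k + 1)) / 2 = ((n : ℤ) + 1 - k) / 2 - 1 := by omega
    push_cast
    rw [if_pos h, if_pos (by omega), if_pos (by omega), h₁, h₂, intChoose_succ]
  · push_cast
    rw [if_neg h, if_neg (by omega), if_neg (by omega), add_zero]

theorem tpowB1_eps_nonneg (n : ℕ) (b : (tpowB1 n).carrier) : 0 ≤ (tpowB1 n).eps b := by
  cases n with
  | zero => exact Int.natCast_nonneg _
  | succ n => exact le_max_of_le_left (Int.natCast_nonneg _)

theorem tpowB1_e_eq_none_iff (n : ℕ) (b : (tpowB1 n).carrier) :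
    (tpowB1 n).e b = none ↔ (tpowB1 n).eps b ≤ 0 := by
  induction n with
  | zero =>
    change Fin 1 at b
    fin_cases b
    simp [tpowB1, B]
  | succ n ih =>
    obtain ⟨a, v⟩ := b
    have ha := tpowB1_eps_nonneg n a
    have h := ih a
    change Fin 2 at v
    fin_cases v
    · by_cases h₁ : 1 < (tpowB1 n).eps a
      · have h₂ : ¬ (tpowB1 n).eps a ≤ 0 := by omega
        simp [tpowB1, tensor, B, h₁, h, h₂]
      · simp [tpowB1, tensor, B, h₁]
        omega
    · by_cases h₁ : 0 < (tpowB1 n).eps a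
      · simp [tpowB1, tensor, B, h₁, h]
      · simp [tpowB1, tensor, B, h₁]

/-- The number of elements of `B(1)^{⊗n}` with `ε ≤ j` and weight `k`. -/
def epsLeCount (n : ℕ) (j k : ℤ) : ℤ :=
  ∑ b : (tpowB1 n).carrier, if (tpowB1 n).eps b ≤ j ∧ (tpowB1 n).wt b = k then 1 else 0

theorem epsLeCount_of_neg (n : ℕ) {j : ℤ} (hj : j < 0) (k : ℤ) : epsLeCount n j k = 0 :=
  Finset.sum_eq_zero fun b _ => if_neg fun h => by
    have := tpowB1_eps_nonneg n b
    omega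

theorem epsLeCount_zero {j : ℤ} (hj : 0 ≤ j) (k : ℤ) :
    epsLeCount 0 j k = if k = 0 then 1 else 0 := by
  change ∑ b : Fin 1, (if ((b : ℕ) : ℤ) ≤ j ∧ ((0 : ℕ) : ℤ) - 2 * ((b : ℕ) : ℤ) = k then 1 else 0)
    = _
  simp [hj, eq_comm]

theorem epsLeCount_succ (n : ℕ) {j : ℤ} (hj : 0 ≤ j) (k : ℤ) :
    epsLeCount (n + 1) j k = epsLeCount n (j + 1) (k - 1) + epsLeCount n (j - 1) (k + 1) := by
  change ∑ p : (tpowB1 n).carrier × Fin 2,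
    (if max ((p.2 : ℕ) : ℤ) ((tpowB1 n).eps p.1 - (((1 : ℕ) : ℤ) - 2 * ((p.2 : ℕ) : ℤ))) ≤ j ∧
      (tpowB1 n).wt p.1 + (((1 : ℕ) : ℤ) - 2 * ((p.2 : ℕ) : ℤ)) = k then 1 else 0) = _
  rw [Fintype.sum_prod_type]
  simp only [Fin.sum_univ_two, Finset.sum_add_distrib, epsLeCount]
  congr 1 <;> refine Finset.sum_congr rfl fun a _ => if_congr ?_ rfl rfl
  · simp
    omega
  · have := tpowB1_eps_nonneg n a
    simp
    omega

theorem epsLeCount_eq_zero (n : ℕ) {j k : ℤ} (h : j + k < 0) : epsLeCount n j k = 0 := by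
  induction n generalizing j k with
  | zero =>
    rcases lt_or_ge j 0 with hj | hj
    · exact epsLeCount_of_neg 0 hj k
    · rw [epsLeCount_zero hj, if_neg (by omega)]
  | succ n ih =>
    rcases lt_or_ge j 0 with hj | hj
    · exact epsLeCount_of_neg _ hj k
    · rw [epsLeCount_succ n hj, ih (by omega), ih (by omega), add_zero]

/-- The reflection principle for `B(1)^{⊗n}`. -/
theorem epsLeCount_eq_sub (n : ℕ) {j k : ℤ} (hj : -1 ≤ j) (h : -1 ≤ j + k) :
    epsLeCount n j k = signSeqCount n k - signSeqCount n (k + 2 * j + 2) := by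
  induction n generalizing j k with
  | zero =>
    rcases hj.eq_or_lt with rfl | hj
    · rw [epsLeCount_of_neg 0 (by norm_num)]
      ring_nf
    · rw [epsLeCount_zero (by omega), signSeqCount_zero, signSeqCount_zero,
        if_neg (by omega : ¬ k + 2 * j + 2 = 0), sub_zero]
  | succ n ih =>
    rcases hj.eq_or_lt with rfl | hj
    · rw [epsLeCount_of_neg _ (by norm_num)]
      ring_nf
    · rw [epsLeCount_succ n (by omega), ih (by omega) (by omega), ih (by omega) (by omega),
        signSeqCount_succ n k, signSeqCount_succ n (k + 2 * j + 2)]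
      ring_nf

theorem mCount_eq_epsLeCount (n : ℕ) (k : ℤ) : (mCount n k : ℤ) = epsLeCount n 0 k := by
  classical
  simp only [mCount, epsLeCount, tpowB1_e_eq_none_iff]
  rw [Nat.card_eq_fintype_card, Fintype.card_subtype, Finset.card_filter]
  push_cast
  rfl

/-- For `n ≥ 0` and `k ∈ ℤ`,
`m_k(n) = C(n, (n−k)/2) − C(n, (n−k)/2 − 1)` if `0 ≤ k ≤ n` and `n − k` is even,
and `m_k(n) = 0` otherwise. -/
theorem mCount_eq_ballot (n : ℕ) (k : ℤ) :
    (mCount n k : ℤ) =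
      if 0 ≤ k ∧ k ≤ (n : ℤ) ∧ 2 ∣ ((n : ℤ) - k) then
        intChoose n (((n : ℤ) - k) / 2) - intChoose n (((n : ℤ) - k) / 2 - 1)
      else 0 := by
  rw [mCount_eq_epsLeCount]
  rcases lt_or_ge k 0 with hk | hk
  · rw [epsLeCount_eq_zero n (by omega), if_neg (by omega)]
  rw [epsLeCount_eq_sub n (by norm_num) (by omega)]
  have hdiv : ((n : ℤ) - (k + 2 * 0 + 2)) / 2 = ((n : ℤ) - k) / 2 - 1 := by omega
  unfold signSeqCount
  rw [hdiv]
  by_cases h : 2 ∣ (n : ℤ) - k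
  · rw [if_pos h, if_pos (by omega)]
    by_cases hkn : k ≤ n
    · rw [if_pos ⟨hk, hkn, h⟩]
    · rw [if_neg (by omega)]
      unfold intChoose
      rw [if_neg (by omega), if_neg (by omega), sub_zero]
  · rw [if_neg h, if_neg (by omega), if_neg (by omega), sub_zero]
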